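/- arXiv:1204.0897 — 5 statements merged into one kernel-verified Lean document; each statement's English description precedes it below -/
import Mathlib

section
/- Let δ > 0 be real, let a_1, …, a_p be nonnegative reals such that a_{i+1} > δ·Σ_{ℓ=1}^{i} a_ℓ for all 1 ≤ i < p, and let K be a natural number with K + 1 ≤ p. Then Σ_{i=1}^{p-K-1} a_i ≤ (1/(1+δ))^K · Σ_{ℓ=1}^{p} a_ℓ. -/
/-- If each term up to index `p` dominates `δ` times the sum of the preceding ones, the prefix sums
up to `p` grow at least geometrically with ratio `1 + δ`. -/
theorem one_add_pow_mul_sum_Icc_le {δ : ℝ} (hδ : 0 ≤ δ) {p : ℕ} {a : ℕ → ℝ}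
    (hgrow : ∀ i < p, δ * ∑ ℓ ∈ Finset.Icc 1 i, a ℓ ≤ a (i + 1)) (m K : ℕ) (hK : m + K ≤ p) :
    (1 + δ) ^ K * ∑ i ∈ Finset.Icc 1 m, a i ≤ ∑ i ∈ Finset.Icc 1 (m + K), a i := by
  induction K with
  | zero => simp
  | succ K ih =>
    have hstep := hgrow (m + K) (by lia)
    have hmul := mul_le_mul_of_nonneg_left (ih (by lia)) (by linarith : 0 ≤ 1 + δ)
    rw [← add_assoc, Finset.sum_Icc_succ_top (by lia), pow_succ']
    linarith

theorem stmt_6 (δ : ℝ) (hδ : 0 < δ) (p : ℕ) (a : ℕ → ℝ)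
    (ha : ∀ i, 1 ≤ i → i ≤ p → 0 ≤ a i)
    (hgrow : ∀ i, 1 ≤ i → i < p → δ * ∑ ℓ ∈ Finset.Icc 1 i, a ℓ < a (i + 1))
    (K : ℕ) (hK : K + 1 ≤ p) :
    ∑ i ∈ Finset.Icc 1 (p - K - 1), a i ≤
      (1 / (1 + δ)) ^ K * ∑ ℓ ∈ Finset.Icc 1 p, a ℓ := by
  have hgrow' : ∀ i < p, δ * ∑ ℓ ∈ Finset.Icc 1 i, a ℓ ≤ a (i + 1) := by
    intro i hi
    rcases Nat.eq_zero_or_pos i with rfl | hpos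
    · simpa using ha 1 le_rfl hi
    · exact (hgrow i hpos hi).le
  have hmono : ∑ i ∈ Finset.Icc 1 (p - K - 1 + K), a i ≤ ∑ i ∈ Finset.Icc 1 p, a i := by
    refine Finset.sum_le_sum_of_subset_of_nonneg
      (Finset.Icc_subset_Icc_right (by lia)) fun i hi _ => ?_
    rw [Finset.mem_Icc] at hi
    exact ha i hi.1 hi.2
  have hgeom := one_add_pow_mul_sum_Icc_le hδ.le hgrow' (p - K - 1) K (by lia)
  rw [one_div, inv_pow, le_inv_mul_iff₀ (by positivity)]
  exact hgeom.trans hmono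
end

section
/- Let δ > 0 and ε > 0 be reals, let a_1, …, a_p be nonnegative reals such that a_{i+1} > δ·Σ_{ℓ=1}^{i} a_ℓ for all 1 ≤ i < p, and let K be a natural number with K + 1 ≤ p such that q := (1/(1+δ))^K satisfies q/(1−q) ≤ ε (in particular q < 1). Then Σ_{i=1}^{p-K-1} a_i ≤ ε·Σ_{i=p-K}^{p} a_i. -/
/-- If each term exceeds `δ` times the sum of its predecessors, then the partial sums grow
geometrically with ratio `1 + δ`. -/
lemma pow_mul_sum_Icc_le {δ : ℝ} (hδ : 0 < δ) {p : ℕ} {a : ℕ → ℝ}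
    (ha : ∀ i, 1 ≤ i → i ≤ p → 0 ≤ a i)
    (hgrow : ∀ i, 1 ≤ i → i < p → δ * ∑ ℓ ∈ Finset.Icc 1 i, a ℓ < a (i + 1))
    (m j : ℕ) (hmj : m + j ≤ p) :
    (1 + δ) ^ j * ∑ i ∈ Finset.Icc 1 m, a i ≤ ∑ i ∈ Finset.Icc 1 (m + j), a i := by
  induction j with
  | zero => simp
  | succ j ih =>
    have hstep : δ * ∑ i ∈ Finset.Icc 1 (m + j), a i ≤ a (m + j + 1) := by
      rcases Nat.eq_zero_or_pos (m + j) with h | h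
      · simpa [h] using ha 1 le_rfl (by omega)
      · exact (hgrow (m + j) h (by omega)).le
    rw [← add_assoc, Finset.sum_Icc_succ_top (by omega), pow_succ']
    have := mul_le_mul_of_nonneg_left (ih (by omega)) (by linarith : 0 ≤ 1 + δ)
    linarith

theorem stmt_7 (δ ε : ℝ) (hδ : 0 < δ) (hε : 0 < ε) (p : ℕ) (a : ℕ → ℝ)
    (ha : ∀ i, 1 ≤ i → i ≤ p → 0 ≤ a i)
    (hgrow : ∀ i, 1 ≤ i → i < p → δ * ∑ ℓ ∈ Finset.Icc 1 i, a ℓ < a (i + 1))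
    (K : ℕ) (hK : K + 1 ≤ p)
    (hq1 : (1 / (1 + δ)) ^ K < 1)
    (hq : (1 / (1 + δ)) ^ K / (1 - (1 / (1 + δ)) ^ K) ≤ ε) :
    ∑ i ∈ Finset.Icc 1 (p - K - 1), a i ≤ ε * ∑ i ∈ Finset.Icc (p - K) p, a i := by
  obtain ⟨m, rfl⟩ : ∃ m, p = m + (K + 1) := ⟨p - (K + 1), by omega⟩
  rw [show m + (K + 1) - K - 1 = m by omega, show m + (K + 1) - K = m + 1 by omega]
  have hsplit : ∑ i ∈ Finset.Icc 1 m, a i + ∑ i ∈ Finset.Icc (m + 1) (m + (K + 1)), a i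
      = ∑ i ∈ Finset.Icc 1 (m + (K + 1)), a i := by
    rw [← Finset.sum_union]
    · congr 1
      ext i
      simp only [Finset.mem_union, Finset.mem_Icc]
      omega
    · rw [Finset.disjoint_left]
      intro i
      simp only [Finset.mem_Icc]
      omega
  have hS : 0 ≤ ∑ i ∈ Finset.Icc 1 m, a i := Finset.sum_nonneg fun i hi => by
    rw [Finset.mem_Icc] at hi
    exact ha i hi.1 (by omega)
  have hT : 0 ≤ ∑ i ∈ Finset.Icc (m + 1) (m + (K + 1)), a i := Finset.sum_nonneg fun i hi => by
    rw [Finset.mem_Icc] at hi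
    exact ha i (by omega) hi.2
  have hgeom := pow_mul_sum_Icc_le hδ ha hgrow m (K + 1) le_rfl
  rw [← hsplit] at hgeom
  set S := ∑ i ∈ Finset.Icc 1 m, a i
  set T := ∑ i ∈ Finset.Icc (m + 1) (m + (K + 1)), a i
  have hpow : (1 + δ) ^ K * S ≤ S + T :=
    (mul_le_mul_of_nonneg_right (pow_le_pow_right₀ (by linarith) K.le_succ) hS).trans hgeom
  have hqS : S ≤ (1 / (1 + δ)) ^ K * (S + T) := by
    rw [one_div, inv_pow, inv_mul_eq_div, le_div_iff₀ (by positivity), mul_comm]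
    exact hpow
  refine le_trans ?_ (mul_le_mul_of_nonneg_right hq hT)
  rw [div_mul_eq_mul_div, le_div_iff₀ (by linarith)]
  linarith
end

section
/- For every real ε with 0 < ε < 1 and every natural number s there exists a natural number K such that the following holds. Let Q_1, …, Q_p be pairwise disjoint finite sets of jobs with weights w(j) ≥ 0 and release dates r(j) ≥ 0 such that rw(Q_{i+1}) > (ε/(1+ε)^s)·Σ_{ℓ=1}^{i} rw(Q_ℓ) for all 1 ≤ i < p, and suppose p ≥ K + 1. Then for every assignment of completion times C with r(j) ≤ C(j) ≤ r(j)·(1+ε)^s for every job j: Σ_{i=1}^{p-K-1} Σ_{j∈Q_i} w(j)·C(j) ≤ ε·Σ_{i=p-K}^{p} Σ_{j∈Q_i} w(j)·C(j). -/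
/-- If each term exceeds a fixed fraction of the preceding partial sum, partial sums grow
geometrically. -/
theorem pow_mul_sum_Icc_le_of_lt {a : ℕ → ℝ} {δ : ℝ} {p m : ℕ} (hδ : 0 ≤ δ) (hm : 1 ≤ m)
    (h : ∀ i, 1 ≤ i → i < p → δ * ∑ l ∈ Finset.Icc 1 i, a l < a (i + 1)) (k : ℕ)
    (hk : m + k ≤ p) :
    (1 + δ) ^ k * ∑ l ∈ Finset.Icc 1 m, a l ≤ ∑ l ∈ Finset.Icc 1 (m + k), a l := by
  induction k with
  | zero => simp
  | succ k ih =>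
    have hstep := h (m + k) (by omega) (by omega)
    have hmul := mul_le_mul_of_nonneg_left (ih (by omega)) (by linarith : 0 ≤ 1 + δ)
    rw [← add_assoc, Finset.sum_Icc_succ_top (by omega), pow_succ']
    linarith

theorem stmt_8 (ε : ℝ) (hε0 : 0 < ε) (hε1 : ε < 1) (s : ℕ) :
    ∃ K : ℕ, ∀ (α : Type) (p : ℕ) (Q : ℕ → Finset α) (w r C : α → ℝ),
      (∀ i, 1 ≤ i → i ≤ p → ∀ i', 1 ≤ i' → i' ≤ p → i ≠ i' →
        Disjoint (Q i) (Q i')) →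
      (∀ i, 1 ≤ i → i ≤ p → ∀ j ∈ Q i, 0 ≤ w j ∧ 0 ≤ r j) →
      (∀ i, 1 ≤ i → i < p →
        ε / (1 + ε) ^ s * ∑ ℓ ∈ Finset.Icc 1 i, ∑ j ∈ Q ℓ, r j * w j <
          ∑ j ∈ Q (i + 1), r j * w j) →
      K + 1 ≤ p →
      (∀ i, 1 ≤ i → i ≤ p → ∀ j ∈ Q i, r j ≤ C j ∧ C j ≤ r j * (1 + ε) ^ s) →
      ∑ i ∈ Finset.Icc 1 (p - K - 1), ∑ j ∈ Q i, w j * C j ≤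
        ε * ∑ i ∈ Finset.Icc (p - K) p, ∑ j ∈ Q i, w j * C j := by
  have hδ : 0 < ε / (1 + ε) ^ s := by positivity
  obtain ⟨K, hK⟩ := pow_unbounded_of_one_lt ((1 + ε) ^ s / ε + 1)
    (by linarith : 1 < 1 + ε / (1 + ε) ^ s)
  refine ⟨K, fun α p Q w r C _ hwr hQ hKp hC => ?_⟩
  obtain ⟨m, rfl⟩ : ∃ m, p = m + (K + 1) := ⟨p - (K + 1), by omega⟩
  rw [show m + (K + 1) - K - 1 = m by omega, show m + (K + 1) - K = m + 1 by omega]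
  set S : ℕ → ℝ := fun n => ∑ i ∈ Finset.Icc 1 n, ∑ j ∈ Q i, r j * w j with hS
  have hSm : 0 ≤ S m := Finset.sum_nonneg fun i hi => Finset.sum_nonneg fun j hj => by
    rw [Finset.mem_Icc] at hi
    have := hwr i hi.1 (by omega) j hj
    exact mul_nonneg this.2 this.1
  have hupper : ∑ i ∈ Finset.Icc 1 m, ∑ j ∈ Q i, w j * C j ≤ (1 + ε) ^ s * S m := by
    simp only [hS, Finset.mul_sum]
    refine Finset.sum_le_sum fun i hi => Finset.sum_le_sum fun j hj => ?_
    rw [Finset.mem_Icc] at hi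
    have h := mul_le_mul_of_nonneg_left (hC i hi.1 (by omega) j hj).2
      (hwr i hi.1 (by omega) j hj).1
    linarith
  have hlower : ∑ i ∈ Finset.Icc (m + 1) (m + (K + 1)), ∑ j ∈ Q i, r j * w j ≤
      ∑ i ∈ Finset.Icc (m + 1) (m + (K + 1)), ∑ j ∈ Q i, w j * C j := by
    refine Finset.sum_le_sum fun i hi => Finset.sum_le_sum fun j hj => ?_
    rw [Finset.mem_Icc] at hi
    have h := mul_le_mul_of_nonneg_left (hC i (by omega) hi.2 j hj).1
      (hwr i (by omega) hi.2 j hj).1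
    linarith
  have hsplit : S (m + (K + 1)) =
      S m + ∑ i ∈ Finset.Icc (m + 1) (m + (K + 1)), ∑ j ∈ Q i, r j * w j := by
    have hIoc (a b : ℕ) : Finset.Icc (a + 1) b = Finset.Ioc a b := by
      ext; simp
    have h := Finset.sum_Ioc_consecutive (fun i => ∑ j ∈ Q i, r j * w j) (Nat.zero_le m)
      (Nat.le_add_right m (K + 1))
    simp only [← hIoc, zero_add] at h
    exact h.symm
  have hgrow : ((1 + ε) ^ s / ε + 1) * S m ≤ S (m + (K + 1)) := by
    rcases Nat.eq_zero_or_pos m with rfl | hm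
    · have h0 : S 0 = 0 := by simp [hS]
      rw [h0, mul_zero]
      refine Finset.sum_nonneg fun i hi => Finset.sum_nonneg fun j hj => ?_
      rw [Finset.mem_Icc] at hi
      have := hwr i hi.1 hi.2 j hj
      exact mul_nonneg this.2 this.1
    · refine le_trans (mul_le_mul_of_nonneg_right ?_ hSm)
        (pow_mul_sum_Icc_le_of_lt hδ.le hm hQ (K + 1) le_rfl)
      exact hK.le.trans (pow_le_pow_right₀ (by linarith) (Nat.le_succ K))
  calc _ ≤ (1 + ε) ^ s * S m := hupper
    _ = ε * ((1 + ε) ^ s / ε * S m) := by field_simp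
    _ ≤ _ := mul_le_mul_of_nonneg_left (by linarith) hε0.le
end

section
/- Let ε be a real with 0 < ε ≤ 1/3, let s, Γ, Δ be natural numbers with Δ·Γ ≥ 1, and let IrOld, IrNew, Rel be pairwise disjoint finite sets of jobs with weights w(j) ≥ 0, release dates r(j) ≥ 0, and completion times C(j). Assume: (i) |IrNew| ≤ Δ·Γ; (ii) there is a map φ : IrNew → IrOld ∪ Rel with w(j) ≤ (ε/(Δ·Γ·(1+ε)^{Γ+s}))·w(φ(j)) and r(j) ≤ (1+ε)^Γ·r(φ(j)) for all j ∈ IrNew; (iii) (1+ε)^s·rw(IrOld) ≤ ε·(rw(IrNew) + rw(Rel)); (iv) C(j) ≤ (1+ε)^s·r(j) for all j ∈ IrOld ∪ IrNew; (v) C(j) ≥ r(j) for all j ∈ Rel. Then Σ_{j∈IrOld∪IrNew} w(j)·C(j) ≤ 3ε·Σ_{j∈Rel} w(j)·C(j). -/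
theorem stmt_10 {α : Type*} [DecidableEq α] (ε : ℝ) (hε0 : 0 < ε) (hε3 : ε ≤ 1 / 3)
    (s Γ Δ : ℕ) (hΔΓ : 1 ≤ Δ * Γ)
    (IrOld IrNew Rel : Finset α)
    (hd1 : Disjoint IrOld IrNew) (hd2 : Disjoint IrOld Rel)
    (hd3 : Disjoint IrNew Rel)
    (w r C : α → ℝ)
    (hw : ∀ j ∈ IrOld ∪ IrNew ∪ Rel, 0 ≤ w j)
    (hr : ∀ j ∈ IrOld ∪ IrNew ∪ Rel, 0 ≤ r j)
    (hcard : IrNew.card ≤ Δ * Γ)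
    (φ : α → α)
    (hφ : ∀ j ∈ IrNew, φ j ∈ IrOld ∪ Rel ∧
      w j ≤ ε / ((Δ : ℝ) * (Γ : ℝ) * (1 + ε) ^ (Γ + s)) * w (φ j) ∧
      r j ≤ (1 + ε) ^ Γ * r (φ j))
    (hold : (1 + ε) ^ s * ∑ j ∈ IrOld, r j * w j ≤
      ε * (∑ j ∈ IrNew, r j * w j + ∑ j ∈ Rel, r j * w j))
    (hCir : ∀ j ∈ IrOld ∪ IrNew, C j ≤ (1 + ε) ^ s * r j)
    (hCrel : ∀ j ∈ Rel, r j ≤ C j) :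
    ∑ j ∈ IrOld ∪ IrNew, w j * C j ≤ 3 * ε * ∑ j ∈ Rel, w j * C j := by
  have hA : 1 ≤ (1 + ε) ^ s := one_le_pow₀ (by linarith)
  have hB : 0 < (1 + ε) ^ Γ := by positivity
  have hD : (1 : ℝ) ≤ (Δ : ℝ) * Γ := by exact_mod_cast hΔΓ
  have hnonneg : ∀ j ∈ IrOld ∪ IrNew ∪ Rel, 0 ≤ r j * w j :=
    fun j hj => mul_nonneg (hr j hj) (hw j hj)
  have hO : 0 ≤ ∑ j ∈ IrOld, r j * w j :=
    Finset.sum_nonneg fun j hj => hnonneg j (by simp [hj])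
  have hN : 0 ≤ ∑ j ∈ IrNew, r j * w j :=
    Finset.sum_nonneg fun j hj => hnonneg j (by simp [hj])
  have hR : 0 ≤ ∑ j ∈ Rel, r j * w j :=
    Finset.sum_nonneg fun j hj => hnonneg j (by simp [hj])
  have hRC : ∑ j ∈ Rel, r j * w j ≤ ∑ j ∈ Rel, w j * C j := by
    refine Finset.sum_le_sum fun j hj => ?_
    rw [mul_comm]
    exact mul_le_mul_of_nonneg_left (hCrel j hj) (hw j (by simp [hj]))
  have hIr : ∑ j ∈ IrOld ∪ IrNew, w j * C j ≤
      (1 + ε) ^ s * (∑ j ∈ IrOld, r j * w j + ∑ j ∈ IrNew, r j * w j) := by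
    rw [← Finset.sum_union hd1, Finset.mul_sum]
    refine Finset.sum_le_sum fun j hj => ?_
    calc w j * C j ≤ w j * ((1 + ε) ^ s * r j) :=
          mul_le_mul_of_nonneg_left (hCir j hj) (hw j (Finset.mem_union_left _ hj))
      _ = (1 + ε) ^ s * (r j * w j) := by ring
  have hnew : (1 + ε) ^ s * ∑ j ∈ IrNew, r j * w j ≤
      ε * (∑ j ∈ IrOld, r j * w j + ∑ j ∈ Rel, r j * w j) := by
    rw [← Finset.sum_union hd2]
    set S := ∑ j ∈ IrOld ∪ Rel, r j * w j with hS
    have hS0 : 0 ≤ S := by rw [hS, Finset.sum_union hd2]; exact add_nonneg hO hR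
    have hterm : ∀ j ∈ IrNew, (1 + ε) ^ s * (r j * w j) ≤ ε / ((Δ : ℝ) * Γ) * S := by
      intro j hj
      obtain ⟨hmem, hwj, hrj⟩ := hφ j hj
      have hmem' : φ j ∈ IrOld ∪ IrNew ∪ Rel := by
        simp only [Finset.mem_union] at hmem ⊢
        tauto
      have hsingle : r (φ j) * w (φ j) ≤ S :=
        Finset.single_le_sum (f := fun i => r i * w i)
          (fun i hi => hnonneg i (by simp only [Finset.mem_union] at hi ⊢; tauto)) hmem
      calc (1 + ε) ^ s * (r j * w j)
          ≤ (1 + ε) ^ s * ((1 + ε) ^ Γ * r (φ j) *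
              (ε / ((Δ : ℝ) * (Γ : ℝ) * (1 + ε) ^ (Γ + s)) * w (φ j))) := by
            refine mul_le_mul_of_nonneg_left ?_ (by positivity)
            exact mul_le_mul hrj hwj (hw j (by simp [hj]))
              (mul_nonneg hB.le (hr _ hmem'))
        _ = ε / ((Δ : ℝ) * Γ) * (r (φ j) * w (φ j)) := by
            have hD' : (Δ : ℝ) * Γ ≠ 0 := by positivity
            have hε : (1 + ε) ≠ 0 := by positivity
            rw [pow_add]
            field_simp
        _ ≤ ε / ((Δ : ℝ) * Γ) * S := by gcongr
    rw [Finset.mul_sum]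
    calc ∑ j ∈ IrNew, (1 + ε) ^ s * (r j * w j)
        ≤ IrNew.card • (ε / ((Δ : ℝ) * Γ) * S) := Finset.sum_le_card_nsmul _ _ _ hterm
      _ ≤ ((Δ : ℝ) * Γ) * (ε / ((Δ : ℝ) * Γ) * S) := by
          rw [nsmul_eq_mul]
          exact mul_le_mul_of_nonneg_right (by exact_mod_cast hcard) (by positivity)
      _ = ε * S := by
          have hD' : (Δ : ℝ) * Γ ≠ 0 := by positivity
          rw [← mul_assoc, mul_div_cancel₀ _ hD']
  set O := ∑ j ∈ IrOld, r j * w j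
  set N := ∑ j ∈ IrNew, r j * w j
  set R := ∑ j ∈ Rel, r j * w j
  have hT : O + N ≤ (1 + ε) ^ s * (O + N) := le_mul_of_one_le_left (add_nonneg hO hN) hA
  have hmain : (1 + ε) ^ s * (O + N) ≤ 3 * ε * R := by
    have hεT := mul_le_mul_of_nonneg_left hT hε0.le
    have hε3T : ε * ((1 + ε) ^ s * (O + N)) ≤ 1 / 3 * ((1 + ε) ^ s * (O + N)) :=
      mul_le_mul_of_nonneg_right hε3 (by positivity)
    linarith
  exact hIr.trans (hmain.trans (mul_le_mul_of_nonneg_left hRC (by positivity)))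
end

section
/- Let Γ be a natural number, let k ≥ 1 be a natural number, let δ ≥ 0 be real, and let f, g : {1, …, Γ} → ℝ satisfy 0 ≤ f(x) ≤ 1 and 0 ≤ g(x) ≤ f(x) + δ for all x. If Π_{x=1}^{Γ} f(x) ≥ k·δ, then Π_{x=1}^{Γ} g(x) ≤ ((k+1)/k)^Γ · Π_{x=1}^{Γ} f(x). -/
/-- A product of numbers in the unit interval is at most each of its factors. -/
theorem prod_le_factor_of_mem_unitInterval {ι : Type*} {s : Finset ι} {f : ι → ℝ}
    (hf : ∀ i ∈ s, 0 ≤ f i ∧ f i ≤ 1) {i : ι} (hi : i ∈ s) : ∏ j ∈ s, f j ≤ f i := by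
  classical
  rw [← Finset.mul_prod_erase s f hi]
  exact mul_le_of_le_one_right (hf i hi).1 <| Finset.prod_le_one
    (fun j hj => (hf j (Finset.mem_of_mem_erase hj)).1)
    (fun j hj => (hf j (Finset.mem_of_mem_erase hj)).2)

theorem stmt_14 (Γ : ℕ) (k : ℕ) (hk : 1 ≤ k) (δ : ℝ) (hδ : 0 ≤ δ)
    (f g : ℕ → ℝ)
    (hf : ∀ x ∈ Finset.Icc 1 Γ, 0 ≤ f x ∧ f x ≤ 1)
    (hg : ∀ x ∈ Finset.Icc 1 Γ, 0 ≤ g x ∧ g x ≤ f x + δ)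
    (hprod : (k : ℝ) * δ ≤ ∏ x ∈ Finset.Icc 1 Γ, f x) :
    ∏ x ∈ Finset.Icc 1 Γ, g x ≤
      (((k : ℝ) + 1) / k) ^ Γ * ∏ x ∈ Finset.Icc 1 Γ, f x := by
  have hk0 : (0 : ℝ) < k := by exact_mod_cast hk
  calc ∏ x ∈ Finset.Icc 1 Γ, g x
      ≤ ∏ x ∈ Finset.Icc 1 Γ, ((k : ℝ) + 1) / k * f x := by
        refine Finset.prod_le_prod (fun x hx => (hg x hx).1) fun x hx => ?_
        have hx' := hprod.trans (prod_le_factor_of_mem_unitInterval hf hx)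
        refine (hg x hx).2.trans ?_
        rw [div_mul_eq_mul_div, le_div_iff₀ hk0]
        linarith
    _ = (((k : ℝ) + 1) / k) ^ Γ * ∏ x ∈ Finset.Icc 1 Γ, f x := by
        rw [Finset.prod_mul_distrib, Finset.prod_const, Nat.card_Icc, Nat.add_sub_cancel]
end
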